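/- Let A be a finite set of m ≥ 3 alternatives, 0 ≤ ε < ε′ < 1 and 0 < δ < 1/2, and set ℓ = ⌈(64/(ε′−ε)²)·(2^{m−1}·m·ln m + ln(1/δ))⌉. Define f on ℓ-tuples of preferences over A by f(S) = 1 iff one can delete at most (ε+ε′)ℓ/2 of the ℓ preferences of S so that the remaining preferences form a single-peaked profile. Then for every fixed profile P of n preferences over A: if there is a set of at most εn preferences of P whose deletion leaves a single-peaked profile, then the probability over sampling that f applied to an ℓ-sample from P equals 1 is at least 1−δ; and if deleting any ε′n preferences of P leaves a profile that is not single-peaked, then the probability that f applied to an ℓ-sample from P equals 0 is at least 1−δ. -/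

import Mathlib

/-- A strict linear order on `A`, encoded as a Boolean relation. -/
def IsLinOrd {A : Type*} (r : A → A → Bool) : Prop :=
  (∀ a, ¬ r a a) ∧ (∀ a b c, r a b → r b c → r a c) ∧ (∀ a b, a ≠ b → r a b ∨ r b a)

instance IsLinOrd.decPred {A : Type*} [Fintype A] [DecidableEq A] :
    DecidablePred (@IsLinOrd A) := fun r => by
  unfold IsLinOrd; infer_instance

/-- A preference: a strict linear order on the set `A` of alternatives. -/
abbrev Pref (A : Type*) := {r : A → A → Bool // IsLinOrd r}

/-- Restriction of a preference to a subset `X` of the alternatives. -/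
def Pref.restrict {A : Type*} (r : Pref A) (X : Finset A) : Pref {a // a ∈ X} :=
  ⟨fun u v => r.1 u.1 v.1, by
    obtain ⟨h1, h2, h3⟩ := r.2
    exact ⟨fun u => h1 u.1, fun u v w => h2 u.1 v.1 w.1,
      fun u v huv => h3 u.1 v.1 (fun h => huv (Subtype.ext h))⟩⟩

/-- `r` is single-peaked with respect to the societal axis `ax`. -/
def SinglePeakedWrt {A : Type*} (ax r : Pref A) : Prop :=
  ∀ t : A, (∀ z, z ≠ t → r.1 t z) → ∀ u v : A,
    (((ax.1 t u ∧ ax.1 u v) ∨ (ax.1 v u ∧ ax.1 u t)) ∨ (u = t ∧ v ≠ t)) → r.1 u v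

/-- A profile is single-peaked if there is a single axis w.r.t. which every preference
of the profile is single-peaked. -/
def IsSinglePeaked {A ι : Type*} (P : ι → Pref A) : Prop :=
  ∃ ax : Pref A, ∀ i, SinglePeakedWrt ax (P i)

/-- A profile (in its given order) is single-crossing: for each ordered pair of
alternatives, the relative order changes at most once along the sequence. -/
def SingleCrossingInOrder {A : Type*} {n : ℕ} (P : Fin n → Pref A) : Prop :=
  ∀ a b : A, ∀ i j k : Fin n, i ≤ j → j ≤ k → (P i).1 a b → (P k).1 a b → (P j).1 a b

/-- A profile is single-crossing if some reordering of its preferences is single-crossing. -/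
def IsSingleCrossing {A ι : Type*} [Fintype ι] (P : ι → Pref A) : Prop :=
  ∃ e : Fin (Fintype.card ι) ≃ ι, SingleCrossingInOrder (fun i => P (e i))

/-- Probability of an event under the uniform distribution on a finite sample space. -/
noncomputable def pr {Ω : Type*} [Fintype Ω] (E : Ω → Prop) : ℝ :=
  haveI := Classical.decPred E
  ((Finset.univ.filter E).card : ℝ) / (Fintype.card Ω : ℝ)

/-- Number of occurrences of the order `q` in the tuple `S` of preferences. -/
noncomputable def countPref {A : Type*} {ℓ : ℕ} (S : Fin ℓ → Pref A) (q : Pref A) : ℕ :=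
  haveI : DecidableEq (Pref A) := Classical.decEq _
  (Finset.univ.filter (fun j => S j = q)).card

/-- Preference-distance of a profile from a domain `D`: `n` minus the maximum size of
an index set whose subprofile lies in a single member of `D`. -/
noncomputable def prefDist {A : Type*} {n : ℕ} (D : Finset (Finset (Pref A)))
    (P : Fin n → Pref A) : ℕ :=
  haveI := Classical.decPred (fun J : Finset (Fin n) => ∃ S ∈ D, ∀ i ∈ J, P i ∈ S)
  n - ((Finset.univ : Finset (Finset (Fin n))).filter
        (fun J => ∃ S ∈ D, ∀ i ∈ J, P i ∈ S)).sup Finset.card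

open Classical in
/-- Exponential Markov bound for the empirical mean of independent uniform draws of a bounded
function with nonpositive mean. -/
lemma pr_le_exp_of_sum_nonpos {n : ℕ} (hn : 1 ≤ n) (ℓ : ℕ) (g : Fin n → ℝ)
    (hg : ∀ i, |g i| ≤ 1) (hsum : ∑ i, g i ≤ 0) (t : ℝ) (ht0 : 0 ≤ t) (ht1 : t ≤ 2) :
    pr (fun σ : Fin ℓ → Fin n => t * ℓ ≤ ∑ j, g (σ j)) ≤ Real.exp (-(ℓ * t ^ 2 / 4)) := by
  have hn' : (0 : ℝ) < n := by exact_mod_cast hn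
  have hmgf : ∑ i, Real.exp (t / 2 * g i) ≤ n * Real.exp (t ^ 2 / 4) := by
    have hpt : ∀ i, Real.exp (t / 2 * g i) ≤ 1 + t / 2 * g i + t ^ 2 / 4 := by
      intro i
      have hb : |t / 2 * g i| ≤ 1 := by
        rw [abs_mul, abs_of_nonneg (by linarith : 0 ≤ t / 2)]
        nlinarith [hg i, abs_nonneg (g i)]
      have h := (abs_le.mp (Real.abs_exp_sub_one_sub_id_le hb)).2
      have hsq : g i ^ 2 ≤ 1 := (sq_le_one_iff_abs_le_one _).mpr (hg i)
      nlinarith [sq_nonneg t]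
    calc ∑ i, Real.exp (t / 2 * g i) ≤ ∑ i, (1 + t / 2 * g i + t ^ 2 / 4) :=
          Finset.sum_le_sum fun i _ => hpt i
      _ = n * (1 + t ^ 2 / 4) + t / 2 * ∑ i, g i := by
          simp only [Finset.sum_add_distrib, ← Finset.mul_sum, Finset.sum_const,
            Finset.card_univ, Fintype.card_fin, nsmul_eq_mul]
          ring
      _ ≤ n * (t ^ 2 / 4 + 1) := by nlinarith
      _ ≤ n * Real.exp (t ^ 2 / 4) := by gcongr; exact Real.add_one_le_exp _
  have hmarkov : ((Finset.univ.filter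
      fun σ : Fin ℓ → Fin n => t * ℓ ≤ ∑ j, g (σ j)).card : ℝ) * Real.exp (t / 2 * (t * ℓ))
      ≤ (∑ i, Real.exp (t / 2 * g i)) ^ ℓ := by
    rw [Fintype.sum_pow, ← nsmul_eq_mul]
    calc _ ≤ ∑ σ ∈ Finset.univ.filter fun σ : Fin ℓ → Fin n => t * ℓ ≤ ∑ j, g (σ j),
            ∏ j, Real.exp (t / 2 * g (σ j)) := by
          refine Finset.card_nsmul_le_sum _ _ _ fun σ hσ => ?_
          rw [← Real.exp_sum, ← Finset.mul_sum]
          have := (Finset.mem_filter.mp hσ).2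
          gcongr
      _ ≤ _ := Finset.sum_le_sum_of_subset_of_nonneg (Finset.filter_subset _ _)
          fun σ _ _ => Finset.prod_nonneg fun j _ => (Real.exp_pos _).le
  have hpow : (∑ i, Real.exp (t / 2 * g i)) ^ ℓ ≤ n ^ ℓ * Real.exp (ℓ * (t ^ 2 / 4)) := by
    rw [Real.exp_nat_mul, ← mul_pow]
    exact pow_le_pow_left₀ (Finset.sum_nonneg fun i _ => (Real.exp_pos _).le) hmgf ℓ
  have hpr : pr (fun σ : Fin ℓ → Fin n => t * ℓ ≤ ∑ j, g (σ j)) =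
      ((Finset.univ.filter
        fun σ : Fin ℓ → Fin n => t * ℓ ≤ ∑ j, g (σ j)).card : ℝ) / (n : ℝ) ^ ℓ := by
    unfold pr
    congr 2
    simp
  rw [hpr, div_le_iff₀ (by positivity)]
  refine le_of_mul_le_mul_right ((hmarkov.trans hpow).trans_eq ?_)
    (Real.exp_pos (t / 2 * (t * ℓ)))
  have : Real.exp (ℓ * (t ^ 2 / 4)) =
      Real.exp (-(ℓ * t ^ 2 / 4)) * Real.exp (t / 2 * (t * ℓ)) := by
    rw [← Real.exp_add]; congr 1; ring
  rw [this]; ring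

lemma one_sub_pr_le {Ω : Type*} [Fintype Ω] [Nonempty Ω] {E F : Ω → Prop}
    (h : ∀ ω, E ω ∨ F ω) : 1 - pr F ≤ pr E := by
  classical
  have hΩ : (0 : ℝ) < Fintype.card Ω := by exact_mod_cast Fintype.card_pos
  unfold pr
  rw [sub_le_iff_le_add, ← add_div, le_div_iff₀ hΩ, one_mul]
  have hcard : Fintype.card Ω ≤ (Finset.univ.filter E).card + (Finset.univ.filter F).card := by
    rw [← Finset.card_univ]
    refine (Finset.card_le_card fun ω _ => ?_).trans (Finset.card_union_le _ _)
    simpa using h ω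
  convert (Nat.cast_le (α := ℝ)).mpr hcard
  push_cast
  congr!

lemma pr_exists_le_sum {Ω ι : Type*} [Fintype Ω] [Fintype ι] (E : ι → Ω → Prop) :
    pr (fun ω => ∃ i, E i ω) ≤ ∑ i, pr (E i) := by
  classical
  unfold pr
  rw [← Finset.sum_div]
  gcongr
  rw [← Nat.cast_sum, Nat.cast_le]
  refine (Finset.card_le_card fun ω hω => ?_).trans Finset.card_biUnion_le
  simpa using hω

lemma pr_mono {Ω : Type*} [Fintype Ω] {E F : Ω → Prop} (h : ∀ ω, E ω → F ω) : pr E ≤ pr F := by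
  classical
  unfold pr
  gcongr
  exact h _

open Classical in
lemma exists_deletion_isSinglePeaked_iff {A ι : Type*} [Fintype ι] (P : ι → Pref A) (c : ℝ) :
    (∃ J : Finset ι, (J.card : ℝ) ≤ c ∧ IsSinglePeaked (fun i : {i : ι // i ∉ J} => P i.1)) ↔
      ∃ ax : Pref A, (∑ i, if SinglePeakedWrt ax (P i) then (0 : ℝ) else 1) ≤ c := by
  have hcard : ∀ ax : Pref A, (∑ i, if SinglePeakedWrt ax (P i) then (0 : ℝ) else 1) =
      ((Finset.univ.filter fun i => ¬ SinglePeakedWrt ax (P i)).card : ℝ) := by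
    intro ax
    rw [Finset.card_filter]
    push_cast
    exact Finset.sum_congr rfl fun i _ => by split_ifs <;> simp_all
  simp only [hcard]
  constructor
  · rintro ⟨J, hJ, ax, hax⟩
    refine ⟨ax, le_trans ?_ hJ⟩
    rw [Nat.cast_le]
    refine Finset.card_le_card fun i hi => ?_
    by_contra hiJ
    exact (Finset.mem_filter.mp hi).2 (hax ⟨i, hiJ⟩)
  · rintro ⟨ax, hax⟩
    exact ⟨_, hax, ax, fun i => by simpa using i.2⟩

lemma card_pref_le (A : Type*) [Fintype A] [Fintype (Pref A)] :
    Fintype.card (Pref A) ≤ 2 ^ (Fintype.card A * Fintype.card A) := by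
  classical
  calc Fintype.card (Pref A) ≤ Fintype.card (A → A → Bool) :=
        Fintype.card_le_of_injective _ Subtype.val_injective
    _ = _ := by simp [pow_mul]

lemma two_pow_mul_self_mul_exp_le {m : ℕ} (hm : 3 ≤ m) {δ x : ℝ} (hδ0 : 0 < δ) (hδ1 : δ ≤ 1)
    (hx : 4 * ((2 : ℝ) ^ (m - 1) * m * Real.log m + Real.log (1 / δ)) ≤ x) :
    (2 : ℝ) ^ (m * m) * Real.exp (-x) ≤ δ := by
  have hm' : (3 : ℝ) ≤ m := by exact_mod_cast hm
  have hlog : Real.log 2 ≤ Real.log m := Real.log_le_log (by norm_num) (by linarith)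
  have hlog2 : 0 < Real.log 2 := Real.log_pos (by norm_num)
  have hpow : (m : ℝ) ≤ 2 ^ (m - 1) := by
    have : m ≤ 2 ^ (m - 1) := by
      have := Nat.lt_two_pow_self (n := m - 1)
      omega
    exact_mod_cast this
  have hmain : (m : ℝ) * m * Real.log 2 ≤ 2 ^ (m - 1) * m * Real.log m := by gcongr
  have hdelta : Real.log (1 / δ) = -Real.log δ := by rw [one_div, Real.log_inv]
  have hdelta0 : Real.log δ ≤ 0 := Real.log_nonpos hδ0.le hδ1
  have h2 : (2 : ℝ) ^ (m * m) = Real.exp (m * m * Real.log 2) := by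
    rw [← Real.exp_log (by positivity : (0 : ℝ) < 2 ^ (m * m)), Real.log_pow]
    push_cast
    rfl
  rw [h2, ← Real.exp_add]
  conv_rhs => rw [← Real.exp_log hδ0]
  have : 0 ≤ (m : ℝ) * m * Real.log 2 := by positivity
  gcongr
  linarith

/-- tester distinguishing profiles that become single-peaked after deleting
at most `εn` preferences from those needing more than `ε'n` deletions. -/
theorem stmt_9 {A : Type*} [Fintype A] [DecidableEq A] (m : ℕ) (hm : Fintype.card A = m)
    (hm3 : 3 ≤ m)
    (ε ε' δ : ℝ) (hε0 : 0 ≤ ε) (hεε' : ε < ε') (hε'1 : ε' < 1)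
    (hδ0 : 0 < δ) (hδ1 : δ < 1/2)
    (ℓ : ℕ)
    (hℓ : ℓ = ⌈(64 / (ε' - ε)^2) *
      ((2:ℝ)^(m-1) * m * Real.log m + Real.log (1/δ))⌉₊)
    (f : (Fin ℓ → Pref A) → Bool)
    (hf : ∀ S : Fin ℓ → Pref A, f S = true ↔
      ∃ J : Finset (Fin ℓ), (J.card : ℝ) ≤ (ε + ε') * ℓ / 2 ∧
        IsSinglePeaked (fun i : {i : Fin ℓ // i ∉ J} => S i.1)) :
    ∀ n : ℕ, 1 ≤ n → ∀ P : Fin n → Pref A,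
      ((∃ J : Finset (Fin n), (J.card : ℝ) ≤ ε * n ∧
          IsSinglePeaked (fun i : {i : Fin n // i ∉ J} => P i.1)) →
        pr (fun σ : Fin ℓ → Fin n => f (fun j => P (σ j)) = true) ≥ 1 - δ) ∧
      ((∀ J : Finset (Fin n), (J.card : ℝ) ≤ ε' * n →
          ¬ IsSinglePeaked (fun i : {i : Fin n // i ∉ J} => P i.1)) →
        pr (fun σ : Fin ℓ → Fin n => f (fun j => P (σ j)) = false) ≥ 1 - δ) := by
  classical
  intro n hn P
  have : Nonempty (Fin n) := ⟨⟨0, hn⟩⟩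
  set t : ℝ := (ε' - ε) / 2 with ht
  have ht0 : 0 < t := by linarith
  have ht2 : t ≤ 2 := by linarith
  have hx : 4 * ((2 : ℝ) ^ (m - 1) * m * Real.log m + Real.log (1 / δ)) ≤ ℓ * t ^ 2 / 4 := by
    have h := Nat.le_ceil ((64 / (ε' - ε)^2) *
      ((2:ℝ)^(m-1) * m * Real.log m + Real.log (1/δ)))
    rw [← hℓ, show ε' - ε = 2 * t by rw [ht]; ring, div_mul_eq_mul_div,
      div_le_iff₀ (by positivity)] at h
    nlinarith
  have hunion := two_pow_mul_self_mul_exp_le hm3 hδ0 (by linarith) hx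
  have hexp : Real.exp (-(ℓ * t ^ 2 / 4)) ≤ δ :=
    le_trans (le_mul_of_one_le_left (Real.exp_pos _).le (one_le_pow₀ (by norm_num))) hunion
  simp only [exists_deletion_isSinglePeaked_iff] at hf
  constructor
  · rw [exists_deletion_isSinglePeaked_iff]
    rintro ⟨ax, hax⟩
    have htail := pr_le_exp_of_sum_nonpos hn ℓ
      (fun i => (if SinglePeakedWrt ax (P i) then (0 : ℝ) else 1) - ε)
      (fun i => by rw [abs_le]; split_ifs <;> constructor <;> linarith)
      (by simp only [Finset.sum_sub_distrib, Finset.sum_const, Finset.card_univ,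
            Fintype.card_fin, nsmul_eq_mul]; linarith)
      t ht0.le ht2
    refine le_trans (by linarith) (one_sub_pr_le (F := _) fun σ => ?_)
    rw [or_iff_not_imp_left, hf]
    intro hσ
    have hlt := not_le.mp (not_exists.mp hσ ax)
    simp only [Finset.sum_sub_distrib, Finset.sum_const, Finset.card_univ,
      Fintype.card_fin, nsmul_eq_mul]
    rw [ht]
    linarith
  · intro hfar
    have hfar' : ∀ ax : Pref A,
        ε' * n < ∑ i, if SinglePeakedWrt ax (P i) then (0 : ℝ) else 1 := by
      intro ax
      by_contra! h
      obtain ⟨J, hJ, hsp⟩ := (exists_deletion_isSinglePeaked_iff P _).mpr ⟨ax, h⟩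
      exact hfar J hJ hsp
    have htail : ∀ ax : Pref A, pr (fun σ : Fin ℓ → Fin n => t * ℓ ≤
        ∑ j, (ε' - if SinglePeakedWrt ax (P (σ j)) then (0 : ℝ) else 1)) ≤
        Real.exp (-(ℓ * t ^ 2 / 4)) := fun ax =>
      pr_le_exp_of_sum_nonpos hn ℓ
        (fun i => ε' - if SinglePeakedWrt ax (P i) then (0 : ℝ) else 1)
        (fun i => by rw [abs_le]; split_ifs <;> constructor <;> linarith)
        (by simp only [Finset.sum_sub_distrib, Finset.sum_const, Finset.card_univ,
              Fintype.card_fin, nsmul_eq_mul]; linarith [hfar' ax])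
        t ht0.le ht2
    have hsum : pr (fun σ : Fin ℓ → Fin n => ∃ ax : Pref A, t * ℓ ≤
        ∑ j, (ε' - if SinglePeakedWrt ax (P (σ j)) then (0 : ℝ) else 1)) ≤ δ := by
      refine (pr_exists_le_sum _).trans ((Finset.sum_le_sum fun ax _ => htail ax).trans ?_)
      rw [Finset.sum_const, nsmul_eq_mul, Finset.card_univ]
      refine le_trans ?_ hunion
      gcongr
      have h := card_pref_le A
      rw [hm] at h
      exact_mod_cast h
    refine le_trans (by linarith) (one_sub_pr_le (F := _) fun σ => ?_)
    rw [or_iff_not_imp_left, Bool.not_eq_false, hf]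
    rintro ⟨ax, hax⟩
    refine ⟨ax, ?_⟩
    simp only [Finset.sum_sub_distrib, Finset.sum_const, Finset.card_univ,
      Fintype.card_fin, nsmul_eq_mul]
    rw [ht]
    linarith
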